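/- arXiv:1810.04628 — 3 statements merged into one kernel-verified Lean document; each statement's English description precedes it below -/
import Mathlib

section
/- Let a ∈ ℤ, N ∈ ℕ with N ≥ 1, and ν ∈ ℝ with N−1 < ν < N, and let p : ℤ → ℝ with p(t) > 0 for all t. Define x(t,s) := (∇_{ρ(s)}^{−ν}(1/p))(t) = ∑_{τ=s}^{t} H_{ν−1}(t, τ−1)·(1/p(τ)). Then x(t,s) is a Cauchy function for the equation ∇[p·(∇_{a*}^ν x)] = 0; that is, for each fixed s ∈ ℕ_{a+N+1}: ∇[t ↦ p(t)·(∇_{ρ(s)*}^ν x(·,s))(t)](t) = 0 for all t ∈ ℕ_{s+N}, (∇_t^i x(·,s))(s−1) = 0 for i = 0, …, N−1, and (∇_t^N x(·,s))(s) = 1/p(s). -/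
/-- Nabla (backward) difference: `∇f(t) = f(t) - f(t-1)`. -/
noncomputable def nabla (f : ℤ → ℝ) : ℤ → ℝ := fun t => f t - f (t - 1)

/-- Nabla fractional Taylor monomial `H_ν(t,a)`, with convention `H_ν(a,a) = 0`. -/
noncomputable def Hmon (ν : ℝ) (t a : ℤ) : ℝ :=
  if t = a then 0
  else Real.Gamma ((t : ℝ) - (a : ℝ) + ν) / (Real.Gamma ((t : ℝ) - (a : ℝ)) * Real.Gamma (ν + 1))

/-- Nabla fractional integral of order `ν` based at `a`:
`(∇_a^{-ν} f)(t) = ∑_{s=a+1}^t H_{ν-1}(t, s-1) f(s)`. -/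
noncomputable def fracSum (ν : ℝ) (a : ℤ) (f : ℤ → ℝ) (t : ℤ) : ℝ :=
  ∑ s ∈ Finset.Icc (a + 1) t, Hmon (ν - 1) t (s - 1) * f s

/-- Nabla Caputo fractional difference of order `ν > 0` based at `a`, with `N = ⌈ν⌉`. -/
noncomputable def caputo (ν : ℝ) (a : ℤ) (f : ℤ → ℝ) (t : ℤ) : ℝ :=
  fracSum ((⌈ν⌉₊ : ℝ) - ν) a (nabla^[⌈ν⌉₊] f) t

/-- The operator `(L_a^ν x)(t) = ∇[p·(∇_{a*}^ν x)](t) + q(t)·x(t-1)`. -/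
noncomputable def Lop (ν : ℝ) (a : ℤ) (p q x : ℤ → ℝ) (t : ℤ) : ℝ :=
  nabla (fun τ => p τ * caputo ν a x τ) t + q t * x (t - 1)

open PowerSeries in
/-- The formal power series `(1 - X)^(-μ)`. -/
noncomputable def negBinomialSeries (μ : ℝ) : PowerSeries ℝ :=
  rescale (-1) (binomialSeries ℝ (-μ))

lemma negBinomialSeries_add (μ ν : ℝ) :
    negBinomialSeries (μ + ν) = negBinomialSeries μ * negBinomialSeries ν := by
  simp [negBinomialSeries, PowerSeries.binomialSeries_add, add_comm]

lemma negBinomialSeries_zero : negBinomialSeries 0 = 1 := by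
  simp [negBinomialSeries]

lemma negBinomialSeries_neg_natCast (n : ℕ) :
    negBinomialSeries (-n) = (1 - PowerSeries.X) ^ n := by
  simp [negBinomialSeries, PowerSeries.binomialSeries_nat, sub_eq_add_neg]

lemma coeff_negBinomialSeries (μ : ℝ) (n : ℕ) :
    PowerSeries.coeff n (negBinomialSeries μ) = Ring.multichoose μ n := by
  rw [negBinomialSeries, PowerSeries.coeff_rescale, PowerSeries.binomialSeries_coeff,
    Ring.choose_neg', ← Int.cast_negOnePow_natCast, Units.smul_def, zsmul_eq_mul, smul_eq_mul,
    mul_one, ← mul_assoc, ← Int.cast_mul, ← Units.val_mul, Int.units_mul_self]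
  simp

lemma Gamma_add_natCast_eq {μ : ℝ} (hμ : 0 < μ) (n : ℕ) :
    Real.Gamma (μ + n) = n.factorial * Ring.multichoose μ n * Real.Gamma μ := by
  have h : (n.factorial : ℝ) * Ring.multichoose μ n = (ascPochhammer ℝ n).eval μ := by
    rw [← nsmul_eq_mul, Ring.factorial_nsmul_multichoose_eq_ascPochhammer,
      Polynomial.ascPochhammer_smeval_eq_eval]
  rw [h]
  clear h
  induction n with
  | zero => simp
  | succ n ih =>
    rw [ascPochhammer_succ_eval, Nat.cast_succ, ← add_assoc,
      Real.Gamma_add_one (by positivity), ih]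
    ring

lemma Hmon_sub_one_add_one_add {μ : ℝ} (hμ : 0 < μ) (c : ℤ) (n : ℕ) :
    Hmon (μ - 1) (c + 1 + n) c = Ring.multichoose μ n := by
  have hG : Real.Gamma ((n : ℝ) + 1) = n.factorial := Real.Gamma_nat_eq_factorial n
  rw [Hmon, if_neg (by omega)]
  push_cast
  rw [show (c : ℝ) + 1 + n - c + (μ - 1) = μ + n by ring,
    show (c : ℝ) + 1 + n - c = n + 1 by ring, sub_add_cancel, hG, Gamma_add_natCast_eq hμ]
  have := (Real.Gamma_pos_of_pos hμ).ne'
  have : (n.factorial : ℝ) ≠ 0 := by positivity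
  field_simp

/-- The generating function of the values of `f` at `b + 1, b + 2, …`. -/
noncomputable def shiftedSeries (b : ℤ) (f : ℤ → ℝ) : PowerSeries ℝ :=
  PowerSeries.mk fun n => f (b + 1 + n)

lemma nabla_iterate_eq_zero {b : ℤ} {f : ℤ → ℝ} (hf : ∀ t ≤ b, f t = 0) (n : ℕ) :
    ∀ t ≤ b, nabla^[n] f t = 0 := by
  induction n with
  | zero => simpa using hf
  | succ n ih =>
    intro t ht
    rw [Function.iterate_succ_apply', nabla, ih t ht, ih (t - 1) (by omega), sub_zero]

lemma shiftedSeries_nabla {b : ℤ} {f : ℤ → ℝ} (hf : f b = 0) :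
    shiftedSeries b (nabla f) = (1 - PowerSeries.X) * shiftedSeries b f := by
  ext n
  rw [sub_mul, one_mul, map_sub]
  cases n with
  | zero => simp [shiftedSeries, nabla, hf]
  | succ n =>
    rw [PowerSeries.coeff_succ_X_mul]
    simp only [shiftedSeries, PowerSeries.coeff_mk, nabla]
    congr 2
    push_cast
    ring

lemma shiftedSeries_nabla_iterate {b : ℤ} {f : ℤ → ℝ} (hf : ∀ t ≤ b, f t = 0) (n : ℕ) :
    shiftedSeries b (nabla^[n] f) = (1 - PowerSeries.X) ^ n * shiftedSeries b f := by
  induction n with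
  | zero => simp
  | succ n ih =>
    rw [Function.iterate_succ_apply', shiftedSeries_nabla (nabla_iterate_eq_zero hf n b le_rfl),
      ih, pow_succ', mul_assoc]

lemma shiftedSeries_fracSum {μ : ℝ} (hμ : 0 < μ) (b : ℤ) (f : ℤ → ℝ) :
    shiftedSeries b (fracSum μ b f) = negBinomialSeries μ * shiftedSeries b f := by
  ext n
  rw [PowerSeries.coeff_mul]
  simp only [shiftedSeries, PowerSeries.coeff_mk, fracSum, coeff_negBinomialSeries]
  symm
  refine Finset.sum_bij' (fun q _ => b + 1 + (q.2 : ℤ))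
    (fun s _ => ((b + 1 + n - s).toNat, (s - (b + 1)).toNat)) ?_ ?_ ?_ ?_ ?_
  · rintro ⟨i, j⟩ h
    rw [Finset.HasAntidiagonal.mem_antidiagonal] at h
    rw [Finset.mem_Icc]
    dsimp only at h ⊢
    omega
  · intro s h
    rw [Finset.mem_Icc] at h
    rw [Finset.HasAntidiagonal.mem_antidiagonal]
    dsimp only
    omega
  · rintro ⟨i, j⟩ h
    rw [Finset.HasAntidiagonal.mem_antidiagonal] at h
    dsimp only at h ⊢
    ext <;> dsimp only <;> omega
  · intro s h
    rw [Finset.mem_Icc] at h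
    dsimp only
    omega
  · rintro ⟨i, j⟩ h
    rw [Finset.HasAntidiagonal.mem_antidiagonal] at h
    dsimp only at h ⊢
    rw [← Hmon_sub_one_add_one_add hμ (b + 1 + j - 1) i]
    congr 2
    omega

lemma fracSum_eq_zero (μ : ℝ) (b : ℤ) (f : ℤ → ℝ) : ∀ t ≤ b, fracSum μ b f t = 0 := by
  intro t ht
  rw [fracSum, Finset.Icc_eq_empty (by omega), Finset.sum_empty]

lemma fracSum_add_one {μ : ℝ} (hμ : 0 < μ) (b : ℤ) (f : ℤ → ℝ) :
    fracSum μ b f (b + 1) = f (b + 1) := by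
  have h := Hmon_sub_one_add_one_add hμ b 0
  simp only [Nat.cast_zero, add_zero, Ring.multichoose_zero_right] at h
  simp [fracSum, h]

lemma nabla_iterate_add_one {b : ℤ} {f : ℤ → ℝ} (hf : ∀ t ≤ b, f t = 0) (n : ℕ) :
    nabla^[n] f (b + 1) = f (b + 1) := by
  induction n with
  | zero => simp
  | succ n ih =>
    rw [Function.iterate_succ_apply', nabla, ih, add_sub_cancel_right,
      nabla_iterate_eq_zero hf n b le_rfl, sub_zero]

/-- The Caputo difference of order `ν` is a left inverse of the fractional integral of order `ν`. -/
lemma caputo_fracSum {ν : ℝ} (hν : 0 < ν) (hν' : ν < ⌈ν⌉₊) (b : ℤ) (f : ℤ → ℝ) {t : ℤ}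
    (ht : b < t) : caputo ν b (fracSum ν b f) t = f t := by
  have h : shiftedSeries b (caputo ν b (fracSum ν b f)) = shiftedSeries b f := by
    change shiftedSeries b (fracSum ((⌈ν⌉₊ : ℝ) - ν) b (nabla^[⌈ν⌉₊] (fracSum ν b f))) = _
    rw [shiftedSeries_fracSum (sub_pos.2 hν'),
      shiftedSeries_nabla_iterate (fracSum_eq_zero ν b f), shiftedSeries_fracSum hν,
      ← negBinomialSeries_neg_natCast, ← mul_assoc, ← mul_assoc, ← negBinomialSeries_add,
      ← negBinomialSeries_add]
    ring_nf
    rw [negBinomialSeries_zero, one_mul]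
  have hc := congrArg (PowerSeries.coeff (t - (b + 1)).toNat) h
  simp only [shiftedSeries, PowerSeries.coeff_mk] at hc
  rwa [show b + 1 + ((t - (b + 1)).toNat : ℤ) = t by omega] at hc

/-- `x(t,s) = (∇_{ρ(s)}^{-ν}(1/p))(t)` is the Cauchy function for `∇[p ∇_{a*}^ν x] = 0`. -/
theorem stmt4 (a : ℤ) (N : ℕ) (hN : 1 ≤ N) (ν : ℝ)
    (hν1 : (N : ℝ) - 1 < ν) (hν2 : ν < N)
    (p : ℤ → ℝ) (hp : ∀ t : ℤ, 0 < p t) :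
    ∀ s : ℤ, a + N + 1 ≤ s →
      (∀ t : ℤ, s + N ≤ t →
        nabla (fun τ => p τ *
          caputo ν (s - 1) (fun r => fracSum ν (s - 1) (fun w => 1 / p w) r) τ) t = 0) ∧
      (∀ i : ℕ, i < N →
        nabla^[i] (fun r => fracSum ν (s - 1) (fun w => 1 / p w) r) (s - 1) = 0) ∧
      nabla^[N] (fun r => fracSum ν (s - 1) (fun w => 1 / p w) r) s = 1 / p s := by
  intro s _
  have hν : 0 < ν := by
    have : (1 : ℝ) ≤ N := by exact_mod_cast hN
    linarith
  have hceil : ⌈ν⌉₊ = N := by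
    rw [Nat.ceil_eq_iff (by omega), Nat.cast_pred (by omega)]
    exact ⟨hν1, hν2.le⟩
  have hzero := fracSum_eq_zero ν (s - 1) (fun w => 1 / p w)
  refine ⟨fun t ht => ?_, fun i _ => nabla_iterate_eq_zero hzero i (s - 1) le_rfl, ?_⟩
  · have key : ∀ τ : ℤ, s - 1 < τ →
        p τ * caputo ν (s - 1) (fun r => fracSum ν (s - 1) (fun w => 1 / p w) r) τ = 1 := by
      intro τ hτ
      rw [caputo_fracSum hν (by rwa [hceil]) (s - 1) (fun w => 1 / p w) hτ]
      exact mul_one_div_cancel (hp τ).ne'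
    simp only [nabla]
    rw [key t (by omega), key (t - 1) (by omega), sub_self]
  · have h := nabla_iterate_add_one hzero N
    rwa [fracSum_add_one hν, sub_add_cancel] at h
end

section
/- Let a ∈ ℤ, N ∈ ℕ with N ≥ 1, and ν ∈ ℝ with N−1 < ν < N. Then x(t,s) := H_ν(t, s−1) is a Cauchy function for the equation ∇(∇_{a*}^ν x) = 0; that is, for each fixed s ∈ ℕ_{a+N+1}: ∇[t ↦ (∇_{ρ(s)*}^ν H_ν(·, s−1))(t)](t) = 0 for all t ∈ ℕ_{s+N}, (∇_t^i H_ν(·, s−1))(s−1) = 0 for i = 0, …, N−1, and (∇_t^N H_ν(·, s−1))(s) = 1. -/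
theorem multichoose_eq_neg_one_pow_mul_choose_neg (r : ℝ) (n : ℕ) :
    Ring.multichoose r n = (-1) ^ n * Ring.choose (-r) n := by
  rw [Ring.choose_neg, ← Ring.multichoose_eq, Units.smul_def, zsmul_eq_mul, ← mul_assoc]
  push_cast [Int.negOnePow_def, zpow_natCast]
  rw [← mul_pow]
  simp

/-- The Chu-Vandermonde identity for `Ring.multichoose`. -/
theorem add_multichoose_eq (r s : ℝ) (k : ℕ) :
    Ring.multichoose (r + s) k =
      ∑ ij ∈ Finset.HasAntidiagonal.antidiagonal k, Ring.multichoose r ij.1 * Ring.multichoose s ij.2 := by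
  rw [multichoose_eq_neg_one_pow_mul_choose_neg, neg_add,
    Ring.add_choose_eq k (Commute.all (-r) (-s)), Finset.mul_sum]
  refine Finset.sum_congr rfl fun ij hij => ?_
  rw [multichoose_eq_neg_one_pow_mul_choose_neg r, multichoose_eq_neg_one_pow_mul_choose_neg s,
    ← Finset.HasAntidiagonal.mem_antidiagonal.mp hij, pow_add]
  ring

theorem Gamma_add_nat_eq_multichoose {r : ℝ} (hr : 0 < r) (n : ℕ) :
    Real.Gamma (r + n) = n.factorial * Ring.multichoose r n * Real.Gamma r := by
  rw [← nsmul_eq_mul, Ring.factorial_nsmul_multichoose_eq_ascPochhammer,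
    Polynomial.ascPochhammer_smeval_eq_eval]
  induction n with
  | zero => simp
  | succ n ih =>
    rw [ascPochhammer_succ_eval, Nat.cast_succ, ← add_assoc,
      Real.Gamma_add_one (by positivity), ih]
    ring

theorem Hmon_add_nat {ν : ℝ} (hν : 0 < ν + 1) (a : ℤ) (n : ℕ) :
    Hmon ν (a + n + 1) a = Ring.multichoose (ν + 1) n := by
  have h1 : (((a + n + 1 : ℤ) : ℝ) - a + ν) = (ν + 1) + n := by push_cast; ring
  have h2 : (((a + n + 1 : ℤ) : ℝ) - a) = n + 1 := by push_cast; ring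
  rw [Hmon, if_neg (by lia), h1, h2, Gamma_add_nat_eq_multichoose hν, Real.Gamma_nat_eq_factorial]
  have := (Real.Gamma_pos_of_pos hν).ne'
  have := Nat.factorial_ne_zero n
  field_simp

theorem Hmon_of_le (ν : ℝ) {t a : ℤ} (h : t ≤ a) : Hmon ν t a = 0 := by
  obtain ⟨n, rfl⟩ := Int.exists_add_of_le h
  rw [Hmon]
  split_ifs
  · rfl
  · rw [show (t : ℝ) - ((t + n : ℤ) : ℝ) = -(n : ℝ) by push_cast; ring, Real.Gamma_neg_nat_eq_zero]
    simp

theorem Hmon_self_add_one {ν : ℝ} (hν : 0 < ν + 1) (a : ℤ) : Hmon ν (a + 1) a = 1 := by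
  simpa using Hmon_add_nat hν a 0

theorem nabla_Hmon {ν : ℝ} (hν : 0 < ν) (a : ℤ) :
    nabla (fun t => Hmon ν t a) = fun t => Hmon (ν - 1) t a := by
  funext t
  simp only [nabla]
  rcases le_or_gt t a with h | h
  · rw [Hmon_of_le _ h, Hmon_of_le _ h, Hmon_of_le _ (by lia), sub_zero]
  · obtain ⟨n, rfl⟩ : ∃ n : ℕ, t = a + n + 1 := ⟨(t - a - 1).toNat, by lia⟩
    rw [Hmon_add_nat (by linarith), Hmon_add_nat (by linarith), sub_add_cancel,
      add_sub_cancel_right]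
    cases n with
    | zero => rw [Hmon_of_le _ (by simp)]; simp
    | succ n =>
      rw [Nat.cast_succ, ← add_assoc, Hmon_add_nat (by linarith), Ring.multichoose_succ_succ]
      ring

theorem nabla_iterate_Hmon {ν : ℝ} (a : ℤ) (i : ℕ) (hν : (i : ℝ) - 1 < ν) :
    nabla^[i] (fun t => Hmon ν t a) = fun t => Hmon (ν - i) t a := by
  induction i with
  | zero => simp
  | succ i ih =>
    push_cast at hν
    rw [Function.iterate_succ_apply', ih (by linarith), nabla_Hmon (by linarith)]
    simp only [Nat.cast_succ, sub_add_eq_sub_sub]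

/-- The power rule for nabla fractional integrals of Taylor monomials. -/
theorem fracSum_Hmon {μ ν : ℝ} (hμ : 0 < μ) (hν : 0 < ν + 1) (a t : ℤ) :
    fracSum μ a (fun r => Hmon ν r a) t = Hmon (ν + μ) t a := by
  rw [fracSum]
  rcases le_or_gt t a with h | h
  · rw [Hmon_of_le _ h, Finset.Icc_eq_empty (by lia), Finset.sum_empty]
  · obtain ⟨n, rfl⟩ : ∃ n : ℕ, t = a + n + 1 := ⟨(t - a - 1).toNat, by lia⟩
    rw [Hmon_add_nat (by linarith), show ν + μ + 1 = μ + (ν + 1) by ring, add_multichoose_eq]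
    symm
    refine Finset.sum_bij' (fun ij _ => a + ij.2 + 1)
      (fun r _ => ((a + n + 1 - r).toNat, (r - a - 1).toNat)) ?_ ?_ ?_ ?_ ?_
    · rintro ⟨i, j⟩ h
      simp only [Finset.HasAntidiagonal.mem_antidiagonal, Finset.mem_Icc] at *
      lia
    · intro r h
      simp only [Finset.HasAntidiagonal.mem_antidiagonal, Finset.mem_Icc] at *
      lia
    · rintro ⟨i, j⟩ h
      simp only [Finset.HasAntidiagonal.mem_antidiagonal, Prod.mk.injEq] at *
      lia
    · intro r h
      simp only [Finset.mem_Icc] at *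
      lia
    · rintro ⟨i, j⟩ h
      simp only [Finset.HasAntidiagonal.mem_antidiagonal] at *
      rw [Hmon_add_nat hν, show a + (n : ℤ) + 1 = (a + j + 1 - 1) + i + 1 by lia,
        Hmon_add_nat (by linarith), sub_add_cancel]

theorem caputo_Hmon {N : ℕ} {ν : ℝ} (hN : 1 ≤ N) (hν1 : (N : ℝ) - 1 < ν) (hν2 : ν < N) (a t : ℤ) :
    caputo ν a (fun r => Hmon ν r a) t = Hmon 0 t a := by
  have hceil : ⌈ν⌉₊ = N := by
    rw [Nat.ceil_eq_iff (by lia)]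
    exact ⟨by rwa [Nat.cast_sub hN, Nat.cast_one], hν2.le⟩
  rw [caputo, hceil, nabla_iterate_Hmon a N hν1, fracSum_Hmon (by linarith) (by linarith)]
  congr 1
  ring

/-- `x(t,s) = H_ν(t, ρ(s))` is the Cauchy function for `∇ ∇_{a*}^ν x = 0`. -/
theorem stmt5 (a : ℤ) (N : ℕ) (hN : 1 ≤ N) (ν : ℝ)
    (hν1 : (N : ℝ) - 1 < ν) (hν2 : ν < N) :
    ∀ s : ℤ, a + N + 1 ≤ s →
      (∀ t : ℤ, s + N ≤ t →
        nabla (fun τ => caputo ν (s - 1) (fun r => Hmon ν r (s - 1)) τ) t = 0) ∧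
      (∀ i : ℕ, i < N → nabla^[i] (fun r => Hmon ν r (s - 1)) (s - 1) = 0) ∧
      nabla^[N] (fun r => Hmon ν r (s - 1)) s = 1 := by
  intro s _
  have hs : s - 1 + 1 = s := by ring
  refine ⟨fun t ht => ?_, fun i hi => ?_, ?_⟩
  · simp only [nabla, caputo_Hmon hN hν1 hν2]
    obtain ⟨n, rfl⟩ : ∃ n : ℕ, t = s - 1 + ((n + 1 : ℕ) : ℤ) + 1 := ⟨(t - s - 1).toNat, by lia⟩
    rw [Hmon_add_nat (by norm_num), add_sub_cancel_right, Nat.cast_succ, ← add_assoc,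
      Hmon_add_nat (by norm_num), zero_add, Ring.multichoose_one, Ring.multichoose_one, sub_self]
  · have : (i : ℝ) < N := by exact_mod_cast hi
    rw [nabla_iterate_Hmon _ i (by linarith)]
    exact Hmon_of_le _ le_rfl
  · rw [nabla_iterate_Hmon _ N hν1]
    simpa only [hs] using Hmon_self_add_one (ν := ν - N) (by linarith) (s - 1)
end

section
/- Let a ∈ ℤ, f : ℤ → ℝ, μ ∈ ℝ with μ > 0 and μ ∉ ℤ, and N ∈ ℕ with N ≥ 1. Then for all t ∈ ℤ with t ≥ a + 1: if N < μ, then (∇^N(∇_a^{−μ} f))(t) = (∇_a^{−(μ−N)} f)(t); and if N > μ, then (∇^N(∇_a^{−μ} f))(t) = (∇_a^{N−μ} f)(t), where ∇_a^{N−μ} is the Riemann–Liouville fractional difference of order N − μ. -/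
/-- Riemann–Liouville nabla fractional difference of order `μ > 0` based at `a`,
with `M = ⌈μ⌉`. -/
noncomputable def rlDiff (μ : ℝ) (a : ℤ) (f : ℤ → ℝ) : ℤ → ℝ :=
  nabla^[⌈μ⌉₊] (fracSum ((⌈μ⌉₊ : ℝ) - μ) a f)

theorem Gamma_ne_zero_of_ne_int {ν : ℝ} (hν : ∀ n : ℤ, ν ≠ n) : Real.Gamma ν ≠ 0 :=
  Real.Gamma_ne_zero fun m => by simpa using hν (-(m : ℤ))

theorem sub_intCast_ne_int {ν : ℝ} (hν : ∀ n : ℤ, ν ≠ n) (k n : ℤ) : ν - k ≠ n := fun h =>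
  hν (n + k) (by push_cast; linarith)

/-- The backward difference lowers the order of a Taylor monomial by one. -/
theorem Hmon_sub_Hmon {ν : ℝ} (hν : ∀ n : ℤ, ν ≠ n) {t b : ℤ} (hbt : b < t) :
    Hmon ν t b - Hmon ν (t - 1) b = Hmon (ν - 1) t b := by
  have hν0 : ν ≠ 0 := by simpa using hν 0
  have hΓ : Real.Gamma ν ≠ 0 := Gamma_ne_zero_of_ne_int hν
  have hΓ1 : Real.Gamma (ν + 1) = ν * Real.Gamma ν := Real.Gamma_add_one hν0
  rcases (Int.add_one_le_iff.mpr hbt).eq_or_lt with rfl | hlt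
  · simp [Hmon, hΓ1, hΓ, hν0, add_comm (1 : ℝ)]
  · have hpos : (0 : ℝ) < (t : ℝ) - b - 1 := by
      have : ((b + 1 : ℤ) : ℝ) < t := Int.cast_lt.mpr hlt
      push_cast at this
      linarith
    set x : ℝ := (t : ℝ) - b - 1 with hx
    have hxν : x + ν ≠ 0 := fun h => hν (-(t - b - 1)) (by push_cast; linarith)
    have hΓx : Real.Gamma x ≠ 0 := (Real.Gamma_pos_of_pos hpos).ne'
    have e₁ : (t : ℝ) - b + ν = x + ν + 1 := by rw [hx]; ring
    have e₂ : (t : ℝ) - b = x + 1 := by rw [hx]; ring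
    have e₃ : ((t - 1 : ℤ) : ℝ) - b = x := by rw [hx]; push_cast; ring
    have e₄ : (t : ℝ) - b + (ν - 1) = x + ν := by rw [hx]; ring
    rw [Hmon, Hmon, Hmon, if_neg (by omega), if_neg (by omega), if_neg (by omega), e₁, e₃, e₄, e₂,
      Real.Gamma_add_one hxν, Real.Gamma_add_one hpos.ne', hΓ1, sub_add_cancel]
    field_simp
    ring

theorem nabla_fracSum {ν : ℝ} (hν : ∀ n : ℤ, ν ≠ n) (a : ℤ) (f : ℤ → ℝ) :
    nabla (fracSum ν a f) = fracSum (ν - 1) a f := by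
  funext t
  have hext : fracSum ν a f (t - 1) =
      ∑ s ∈ Finset.Icc (a + 1) t, Hmon (ν - 1) (t - 1) (s - 1) * f s := by
    refine Finset.sum_subset (Finset.Icc_subset_Icc_right (by omega)) fun s hs hs' => ?_
    rw [Finset.mem_Icc] at hs hs'
    obtain rfl : s = t := by omega
    simp [Hmon]
  rw [nabla, hext, fracSum, fracSum, ← Finset.sum_sub_distrib]
  refine Finset.sum_congr rfl fun s hs => ?_
  rw [Finset.mem_Icc] at hs
  rw [← sub_mul, Hmon_sub_Hmon (by simpa using sub_intCast_ne_int hν 1) (by omega)]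

theorem nabla_iterate_fracSum {ν : ℝ} (hν : ∀ n : ℤ, ν ≠ n) (a : ℤ) (f : ℤ → ℝ) (N : ℕ) :
    nabla^[N] (fracSum ν a f) = fracSum (ν - N) a f := by
  induction N with
  | zero => simp
  | succ N ih =>
    rw [Function.iterate_succ_apply', ih,
      nabla_fracSum (by simpa using sub_intCast_ne_int hν N)]
    push_cast
    rw [sub_sub]

/-- Composition rule: `∇^N ∇_a^{-μ} f = ∇_a^{N-μ} f`. -/
theorem stmt14 (a : ℤ) (f : ℤ → ℝ) (μ : ℝ) (hμ : 0 < μ) (hint : ∀ n : ℤ, μ ≠ n)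
    (N : ℕ) (hN : 1 ≤ N) :
    ∀ t : ℤ, a + 1 ≤ t →
      ((N : ℝ) < μ → nabla^[N] (fracSum μ a f) t = fracSum (μ - N) a f t) ∧
      (μ < N → nabla^[N] (fracSum μ a f) t = rlDiff ((N : ℝ) - μ) a f t) := by
  intro t _
  have hμN := nabla_iterate_fracSum hint a f N
  refine ⟨fun _ => by rw [hμN], fun _ => ?_⟩
  have hM (n : ℤ) : (⌈(N : ℝ) - μ⌉₊ : ℝ) - (N - μ) ≠ n := fun h =>
    hint (n + N - ⌈(N : ℝ) - μ⌉₊) (by push_cast; linarith)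
  rw [hμN, rlDiff, nabla_iterate_fracSum hM]
  congr 1
  ring
end
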